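/- Fix 0 < α, β < 1 and n ∈ ℕ, and let M = {m_1, …, m_n} ⊂ ℕ₀ be any set of n distinct indices. Then the following two subsets of the maximal domain D_max^{J,n} coincide: { f ∈ D_max^{J,n} : lim_{x→1⁻}[f,P_j^{(α,β)}]_n(x) = 0 and lim_{x→-1⁺}[f,P_j^{(α,β)}]_n(x) = 0 for all j = 0, …, n-1 } and { f ∈ D_max^{J,n} : lim_{x→1⁻}[f,P_m^{(α,β)}]_n(x) = 0 and lim_{x→-1⁺}[f,P_m^{(α,β)}]_n(x) = 0 for all m ∈ M }. That is, GKN boundary conditions built from ANY n Jacobi polynomials determine the same self-adjoint (left-definite) domain as those built from the first n Jacobi polynomials. -/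

import Mathlib

open MeasureTheory Set Filter Topology

/-- Membership in the weighted space `L²_{α,β}(-1,1)`. -/
def MemL2ab (α β : ℝ) (f : ℝ → ℂ) : Prop :=
  IntegrableOn (fun x : ℝ => ‖f x‖ ^ 2 * (1 - x) ^ α * (1 + x) ^ β) (Ioo (-1 : ℝ) 1)

/-- The Jacobi differential expression
`ℓ_{α,β}[f](x) = -(1-x)^{-α}(1+x)^{-β}·[(1-x)^{α+1}(1+x)^{β+1} f'(x)]'`. -/
noncomputable def jacobiL (α β : ℝ) (f : ℝ → ℂ) : ℝ → ℂ := fun x =>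
  -((((1 - x) ^ (-α) * (1 + x) ^ (-β) : ℝ) : ℂ) *
    deriv (fun y : ℝ => (((1 - y) ^ (α + 1) * (1 + y) ^ (β + 1) : ℝ) : ℂ) * deriv f y) x)

/-- The maximal domain `D_max^{J,n}` of the `n`-th power of the Jacobi expression:
`C^{2n}` functions on `(-1,1)` with `f ∈ L²_{α,β}` and `ℓ^n_{α,β}[f] ∈ L²_{α,β}`. -/
def JacobiMaxDom (α β : ℝ) (n : ℕ) (f : ℝ → ℂ) : Prop :=
  ContDiffOn ℝ (2 * n) f (Ioo (-1 : ℝ) 1) ∧ MemL2ab α β f ∧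
    MemL2ab α β ((jacobiL α β)^[n] f)

/-- The coefficient function `a_k(x) = (1-x)^{α+k}(1+x)^{β+k}`. -/
noncomputable def ak (α β : ℝ) (k : ℕ) (x : ℝ) : ℝ :=
  (1 - x) ^ (α + (k : ℝ)) * (1 + x) ^ (β + (k : ℝ))

/-- The `n`-th Jacobi sesquilinear form (for real-valued `g`; no conjugation):
`[f,g]_n(x) = Σ_{k=1}^{n} Σ_{j=1}^{k} (-1)^{k+j} { (a_k g^{(k)})^{(k-j)} f^{(j-1)}
 − (a_k f^{(k)})^{(k-j)} g^{(j-1)} }`. -/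
noncomputable def sesq (α β : ℝ) (n : ℕ) (f g : ℝ → ℂ) (x : ℝ) : ℂ :=
  ∑ k ∈ Finset.Icc 1 n, ∑ j ∈ Finset.Icc 1 k, (-1 : ℂ) ^ (k + j) *
    (iteratedDeriv (k - j) (fun y => ((ak α β k y : ℝ) : ℂ) * iteratedDeriv k g y) x *
        iteratedDeriv (j - 1) f x -
      iteratedDeriv (k - j) (fun y => ((ak α β k y : ℝ) : ℂ) * iteratedDeriv k f y) x *
        iteratedDeriv (j - 1) g x)

/-- The rising Pochhammer symbol `(a)_r = a(a+1)⋯(a+r-1)`. -/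
noncomputable def poch (a : ℝ) (r : ℕ) : ℝ := ∏ i ∈ Finset.range r, (a + i)

/-- The `m`-th Jacobi polynomial
`P_m^{(α,β)}(x) = Σ_{j=0}^{m} (-1/2)^j ((m+α+β+1)_j (α+j+1)_{m-j}) / (j!(m-j)!) (1-x)^j`. -/
noncomputable def jacobiP (α β : ℝ) (m : ℕ) (x : ℝ) : ℝ :=
  ∑ j ∈ Finset.range (m + 1),
    (-(1 : ℝ) / 2) ^ j *
      (poch ((m : ℝ) + α + β + 1) j * poch (α + (j : ℝ) + 1) (m - j)) /
      ((j.factorial : ℝ) * ((m - j).factorial : ℝ)) * (1 - x) ^ j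

theorem xx_rpow_hd {α : ℝ} {c s x : ℝ} (h : 0 < c + s * x) :
    HasDerivAt (fun y : ℝ => (c + s * y) ^ α) (s * α * (c + s * x) ^ (α - 1)) x := by
  have h1 : HasDerivAt (fun y : ℝ => c + s * y) s x := by
    simpa using ((hasDerivAt_id x).const_mul s).const_add c
  exact h1.rpow_const (Or.inl h.ne')

theorem ak_pos (α β : ℝ) (k : ℕ) {x : ℝ} (hx : x ∈ Ioo (-1 : ℝ) 1) : 0 < ak α β k x := by
  have h1 : 0 < 1 - x := by linarith [hx.2]
  have h2 : 0 < 1 + x := by linarith [hx.1]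
  unfold ak; positivity

theorem ak_succ (α β : ℝ) (k : ℕ) {x : ℝ} (hx : x ∈ Ioo (-1 : ℝ) 1) :
    ak α β (k + 1) x = (1 - x ^ 2) * ak α β k x := by
  have h1 : 0 < 1 - x := by linarith [hx.2]
  have h2 : 0 < 1 + x := by linarith [hx.1]
  unfold ak
  push_cast
  rw [← add_assoc, ← add_assoc, Real.rpow_add_one h1.ne', Real.rpow_add_one h2.ne']
  ring

theorem ak_hasDerivAt (α β : ℝ) (k : ℕ) {x : ℝ} (hx : x ∈ Ioo (-1 : ℝ) 1) :
    HasDerivAt (ak α β (k + 1)) (ak α β k x * (β - α - (α + β + 2 + 2 * k) * x)) x := by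
  have h1 : 0 < 1 - x := by linarith [hx.2]
  have h2 : 0 < 1 + x := by linarith [hx.1]
  have d1 := xx_rpow_hd (α := α + ((k + 1 : ℕ) : ℝ)) (c := 1) (s := -1) (x := x) (by linarith)
  have d2 := xx_rpow_hd (α := β + ((k + 1 : ℕ) : ℝ)) (c := 1) (s := 1) (x := x) (by linarith)
  have d := d1.mul d2
  have e : ∀ y : ℝ, ak α β (k+1) y = (1 + -1 * y) ^ (α + ((k + 1 : ℕ) : ℝ)) *
      (1 + 1 * y) ^ (β + ((k + 1 : ℕ) : ℝ)) := by
    intro y; unfold ak; congr 2 <;> ring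
  refine (d.congr_of_eventuallyEq (Eventually.of_forall e)).congr_deriv ?_
  have f1 : (1 + -1 * x) = 1 - x := by ring
  have f2 : (1 + 1 * x) = 1 + x := by ring
  rw [f1, f2]
  unfold ak
  push_cast
  rw [← add_assoc, ← add_assoc, Real.rpow_add_one h1.ne', Real.rpow_add_one h2.ne',
    add_sub_cancel_right, add_sub_cancel_right]
  ring

theorem ak_contDiffAt (α β : ℝ) (k : ℕ) {x : ℝ} (hx : x ∈ Ioo (-1 : ℝ) 1) (m : WithTop ℕ∞) :
    ContDiffAt ℝ m (ak α β k) x := by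
  have h1 : 0 < 1 - x := by linarith [hx.2]
  have h2 : 0 < 1 + x := by linarith [hx.1]
  unfold ak
  exact ((contDiffAt_const.sub contDiffAt_id).rpow_const_of_ne h1.ne').mul
    ((contDiffAt_const.add contDiffAt_id).rpow_const_of_ne h2.ne')

theorem ak_continuousOn (α β : ℝ) (k : ℕ) : ContinuousOn (ak α β k) (Ioo (-1 : ℝ) 1) :=
  fun _ hx => (ak_contDiffAt α β k hx 0).continuousAt.continuousWithinAt

theorem contDiffOn_iter {m k : ℕ} {h : ℝ → ℂ}
    (hh : ContDiffOn ℝ ((m + k : ℕ) : WithTop ℕ∞) h (Ioo (-1 : ℝ) 1)) :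
    ContDiffOn ℝ (m : WithTop ℕ∞) (iteratedDeriv k h) (Ioo (-1 : ℝ) 1) := by
  induction k generalizing m with
  | zero => simpa using hh
  | succ k ih =>
    rw [iteratedDeriv_succ]
    have := ih (m := m + 1) (by convert hh using 2; ring)
    exact this.deriv_of_isOpen isOpen_Ioo (by norm_cast)

theorem hasDerivAt_iter {m k : ℕ} {h : ℝ → ℂ}
    (hh : ContDiffOn ℝ (m : WithTop ℕ∞) h (Ioo (-1 : ℝ) 1)) (hk : k < m) {x : ℝ}
    (hx : x ∈ Ioo (-1 : ℝ) 1) :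
    HasDerivAt (iteratedDeriv k h) (iteratedDeriv (k + 1) h x) x := by
  obtain ⟨d, rfl⟩ := Nat.exists_eq_add_of_lt hk
  have h1 : ContDiffOn ℝ ((d + 1 : ℕ) : WithTop ℕ∞) (iteratedDeriv k h) (Ioo (-1 : ℝ) 1) :=
    contDiffOn_iter (by convert hh using 2; ring)
  have h2 := (h1.differentiableOn (by norm_cast)).differentiableAt (Ioo_mem_nhds hx.1 hx.2)
  rw [iteratedDeriv_succ]
  exact h2.hasDerivAt

theorem ofReal_hd {f : ℝ → ℝ} {f' x : ℝ} (h : HasDerivAt f f' x) :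
    HasDerivAt (fun y => ((f y : ℝ) : ℂ)) ((f' : ℝ) : ℂ) x := h.ofReal_comp

theorem jacobiL_eq (α β : ℝ) {h : ℝ → ℂ} (hh : ContDiffOn ℝ ((2 : ℕ) : WithTop ℕ∞) h (Ioo (-1 : ℝ) 1))
    {x : ℝ} (hx : x ∈ Ioo (-1 : ℝ) 1) :
    jacobiL α β h x = -((1 - (x : ℂ) ^ 2) * iteratedDeriv 2 h x +
      (((β - α - (α + β + 2) * x : ℝ)) : ℂ) * iteratedDeriv 1 h x) := by
  have h1 : 0 < 1 - x := by linarith [hx.2]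
  have h2 : 0 < 1 + x := by linarith [hx.1]
  have d0 := hasDerivAt_iter hh (k := 1) (by norm_num) hx
  have d := (ofReal_hd (ak_hasDerivAt α β 0 hx)).mul d0
  have e : (fun y : ℝ => (((1 - y) ^ (α + 1) * (1 + y) ^ (β + 1) : ℝ) : ℂ) * deriv h y) =
      ((fun y => ((ak α β (0 + 1) y : ℝ) : ℂ)) * iteratedDeriv 1 h) := by
    funext y
    simp [ak, iteratedDeriv_one]
  unfold jacobiL
  rw [e, d.deriv]
  have hw : (((1 - x) ^ (-α) * (1 + x) ^ (-β) : ℝ) : ℂ) * ((ak α β 0 x : ℝ) : ℂ) = 1 := by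
    rw [← Complex.ofReal_mul]
    have : (1 - x) ^ (-α) * (1 + x) ^ (-β) * ak α β 0 x = 1 := by
      unfold ak
      rw [Real.rpow_neg h1.le, Real.rpow_neg h2.le]
      have p1 : 0 < (1 - x) ^ α := by positivity
      have p2 : 0 < (1 + x) ^ β := by positivity
      simp
      field_simp
    rw [this]; simp
  rw [ak_succ _ _ _ hx]
  generalize (((1 - x) ^ (-α) * (1 + x) ^ (-β) : ℝ) : ℂ) = u at *
  push_cast
  linear_combination (-((1 - (x : ℂ) ^ 2) * iteratedDeriv 2 h x +
      (((β - α - (α + β + 2) * x )) : ℂ) * iteratedDeriv 1 h x)) * hw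

theorem jacobiL_contDiffOn (α β : ℝ) {h : ℝ → ℂ} {m : ℕ}
    (hh : ContDiffOn ℝ ((m + 2 : ℕ) : WithTop ℕ∞) h (Ioo (-1 : ℝ) 1)) :
    ContDiffOn ℝ (m : WithTop ℕ∞) (jacobiL α β h) (Ioo (-1 : ℝ) 1) := by
  have hh2 : ContDiffOn ℝ ((2 : ℕ) : WithTop ℕ∞) h (Ioo (-1 : ℝ) 1) :=
    hh.of_le (by norm_cast; omega)
  have hh1 : ContDiffOn ℝ ((m + 1 : ℕ) : WithTop ℕ∞) h (Ioo (-1 : ℝ) 1) :=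
    hh.of_le (by norm_cast; omega)
  refine ContDiffOn.congr ?_ (fun x hx => jacobiL_eq α β hh2 hx)
  have c2 := contDiffOn_iter (m := m) (k := 2) hh
  have c1 := contDiffOn_iter (m := m) (k := 1) hh1
  have s1 : ContDiff ℝ (m : WithTop ℕ∞) (fun x : ℝ => (1 - (x : ℂ) ^ 2)) :=
    contDiff_const.sub (Complex.ofRealCLM.contDiff.pow 2)
  have s2 : ContDiff ℝ (m : WithTop ℕ∞) (fun x : ℝ => (((β - α - (α + β + 2) * x : ℝ)) : ℂ)) :=
    Complex.ofRealCLM.contDiff.comp (contDiff_const.sub (contDiff_const.mul contDiff_id))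
  exact ((s1.contDiffOn.mul c2).add (s2.contDiffOn.mul c1)).neg

/-- eigenvalues -/
noncomputable def lam (α β : ℝ) (k : ℕ) : ℝ := k * (k + α + β + 1)

theorem iter_jacobiL (α β : ℝ) {h : ℝ → ℂ} (k : ℕ)
    (hh : ContDiffOn ℝ ((k + 2 : ℕ) : WithTop ℕ∞) h (Ioo (-1 : ℝ) 1))
    {x : ℝ} (hx : x ∈ Ioo (-1 : ℝ) 1) :
    iteratedDeriv k (jacobiL α β h) x = -((1 - (x : ℂ) ^ 2) * iteratedDeriv (k + 2) h x +
      (((β - α - (α + β + 2 + 2 * k) * x : ℝ)) : ℂ) * iteratedDeriv (k + 1) h x) +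
      ((lam α β k : ℝ) : ℂ) * iteratedDeriv k h x := by
  induction k generalizing x with
  | zero => simp [jacobiL_eq α β hh hx, lam]
  | succ k ih =>
    have ih' := @ih (hh.of_le (by norm_cast; omega))
    rw [iteratedDeriv_succ]
    have ev : iteratedDeriv k (jacobiL α β h) =ᶠ[𝓝 x] fun x : ℝ =>
      -((1 - (x : ℂ) ^ 2) * iteratedDeriv (k + 2) h x +
      (((β - α - (α + β + 2 + 2 * k) * x : ℝ)) : ℂ) * iteratedDeriv (k + 1) h x) +
      ((lam α β k : ℝ) : ℂ) * iteratedDeriv k h x := by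
      filter_upwards [Ioo_mem_nhds hx.1 hx.2] with y hy using ih' hy
    rw [ev.deriv_eq]
    have d2 := hasDerivAt_iter hh (k := k + 2) (by omega) hx
    have d1 := hasDerivAt_iter hh (k := k + 1) (by omega) hx
    have d0 := hasDerivAt_iter hh (k := k) (by omega) hx
    have q0 : HasDerivAt (fun y : ℝ => (y : ℂ)) 1 x := Complex.ofRealCLM.hasDerivAt
    have q1 := (q0.pow 2).const_sub 1
    have q2 : HasDerivAt (fun y : ℝ => (((β - α - (α + β + 2 + 2 * k) * y : ℝ)) : ℂ))
        ((-((α + β + 2 + 2 * k)) : ℝ) : ℂ) x := by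
      apply ofReal_hd
      simpa using ((hasDerivAt_id x).const_mul (α + β + 2 + 2 * (k : ℝ))).const_sub (β - α)
    have d := (((q1.mul d2).add (q2.mul d1)).neg).add (d0.const_mul ((lam α β k : ℝ) : ℂ))
    refine (HasDerivAt.deriv d).trans ?_
    simp [lam]
    ring

theorem key_hd (α β : ℝ) {h : ℝ → ℂ} (k : ℕ)
    (hh : ContDiffOn ℝ ((k + 2 : ℕ) : WithTop ℕ∞) h (Ioo (-1 : ℝ) 1))
    {x : ℝ} (hx : x ∈ Ioo (-1 : ℝ) 1) :
    HasDerivAt (fun y => ((ak α β (k + 1) y : ℝ) : ℂ) * iteratedDeriv (k + 1) h y)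
      (((lam α β k : ℝ) : ℂ) * (((ak α β k x : ℝ) : ℂ) * iteratedDeriv k h x) -
        ((ak α β k x : ℝ) : ℂ) * iteratedDeriv k (jacobiL α β h) x) x := by
  have d1 := hasDerivAt_iter hh (k := k + 1) (by omega) hx
  refine ((ofReal_hd (ak_hasDerivAt α β k hx)).mul d1).congr_deriv ?_
  rw [iter_jacobiL α β k hh hx, ak_succ _ _ _ hx]
  push_cast
  ring

theorem expand (α β : ℝ) {f : ℝ → ℂ} {n : ℕ}
    (hf : ∀ i ≤ n, ContDiffOn ℝ ((2 * (n - i) : ℕ) : WithTop ℕ∞) ((jacobiL α β)^[i] f) (Ioo (-1 : ℝ) 1))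
    (d : ℕ) : ∀ j, j + d ≤ n → ∃ c : ℕ → ℂ, ∀ x ∈ Ioo (-1 : ℝ) 1,
      iteratedDeriv d (fun y => ((ak α β (j + d) y : ℝ) : ℂ) * iteratedDeriv (j + d) f y) x =
      ∑ i ∈ Finset.range (d + 1),
        c i * (((ak α β j x : ℝ) : ℂ) * iteratedDeriv j ((jacobiL α β)^[i] f) x) := by
  induction d with
  | zero =>
    intro j _
    exact ⟨fun _ => 1, fun x _ => by simp⟩
  | succ d ih =>
    intro j hj
    obtain ⟨c, hc⟩ := ih (j + 1) (by omega)
    refine ⟨fun i => (if i ≤ d then c i * ((lam α β j : ℝ) : ℂ) else 0) -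
      (match i with | 0 => 0 | i + 1 => c i), fun x hx => ?_⟩
    have e : j + 1 + d = j + (d + 1) := by ring
    rw [e] at hc
    rw [iteratedDeriv_succ]
    have ev : iteratedDeriv d (fun y => ((ak α β (j + (d + 1)) y : ℝ) : ℂ) *
        iteratedDeriv (j + (d + 1)) f y) =ᶠ[𝓝 x] fun x => ∑ i ∈ Finset.range (d + 1),
        c i * (((ak α β (j + 1) x : ℝ) : ℂ) * iteratedDeriv (j + 1) ((jacobiL α β)^[i] f) x) := by
      filter_upwards [Ioo_mem_nhds hx.1 hx.2] with y hy using hc y hy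
    rw [ev.deriv_eq]
    have hd := HasDerivAt.fun_sum (u := Finset.range (d + 1)) (x := x) (fun i hi =>
      (key_hd α β (h := (jacobiL α β)^[i] f) j ((hf i (by
        have := Finset.mem_range.1 hi; omega)).of_le (by
        have := Finset.mem_range.1 hi
        norm_cast; omega)) hx).const_mul (c i))
    rw [hd.deriv]
    simp only [sub_mul, Finset.sum_sub_distrib, mul_sub]
    congr 1
    · rw [Finset.sum_range_succ _ (d + 1)]
      simp only [show ¬ (d + 1 ≤ d) by omega, if_false, zero_mul, add_zero]
      refine Finset.sum_congr rfl fun i hi => ?_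
      rw [if_pos (by have := Finset.mem_range.1 hi; omega)]
      ring
    · rw [Finset.sum_range_succ' _ (d + 1)]
      simp only [zero_mul, add_zero]
      refine Finset.sum_congr rfl fun i hi => ?_
      rw [Function.iterate_succ_apply']

theorem contDiff_iterate (α β : ℝ) {f : ℝ → ℂ} {n : ℕ}
    (hf : ContDiffOn ℝ ((2 * n : ℕ) : WithTop ℕ∞) f (Ioo (-1 : ℝ) 1)) :
    ∀ i ≤ n, ContDiffOn ℝ ((2 * (n - i) : ℕ) : WithTop ℕ∞) ((jacobiL α β)^[i] f) (Ioo (-1 : ℝ) 1) := by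
  intro i
  induction i with
  | zero => intro _; simpa using hf
  | succ i ih =>
    intro hi
    rw [Function.iterate_succ_apply']
    apply jacobiL_contDiffOn
    convert ih (by omega) using 2
    omega

/-- limits at both endpoints -/
def HasLims (F : ℝ → ℂ) : Prop :=
  ∃ a b : ℂ, Tendsto F (𝓝[<] (1 : ℝ)) (𝓝 a) ∧ Tendsto F (𝓝[>] (-1 : ℝ)) (𝓝 b)

/-- bounded on the open interval -/
def Bdd (F : ℝ → ℂ) : Prop := ∃ C : ℝ, ∀ x ∈ Ioo (-1 : ℝ) 1, ‖F x‖ ≤ C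

theorem Bdd.integrableOn {F : ℝ → ℂ} (h : Bdd F) (hc : ContinuousOn F (Ioo (-1 : ℝ) 1)) :
    IntegrableOn F (Ioo (-1 : ℝ) 1) := by
  obtain ⟨C, hC⟩ := h
  refine IntegrableOn.of_bound (C := C) (by simp) (hc.aestronglyMeasurable measurableSet_Ioo) ?_
  exact (ae_restrict_iff' measurableSet_Ioo).2 (Eventually.of_forall hC)

theorem lims_of_deriv {F G : ℝ → ℂ} (hd : ∀ x ∈ Ioo (-1 : ℝ) 1, HasDerivAt F (G x) x)
    (hG : IntegrableOn G (Ioo (-1 : ℝ) 1)) : HasLims F ∧ Bdd F := by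
  have hI : IntegrableOn G (Icc (-1 : ℝ) 1) := (integrableOn_Icc_iff_integrableOn_Ioo).2 hG
  have hII : IntervalIntegrable G volume (-1) 1 :=
    (intervalIntegrable_iff_integrableOn_Icc_of_le (by norm_num)).2 hI
  have hcont : ContinuousOn (fun x => ∫ t in (0 : ℝ)..x, G t) (Icc (-1 : ℝ) 1) := by
    have := intervalIntegral.continuousOn_primitive_interval' (a := (0 : ℝ)) hII (by
      rw [uIcc_of_le (by norm_num)]; norm_num)
    rwa [uIcc_of_le (by norm_num)] at this
  have hcont' : ContinuousOn (fun x => F 0 + ∫ t in (0 : ℝ)..x, G t) (Icc (-1 : ℝ) 1) :=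
    continuousOn_const.add hcont
  have heq : ∀ x ∈ Ioo (-1 : ℝ) 1, F 0 + ∫ t in (0 : ℝ)..x, G t = F x := by
    intro x hx
    have hsub : uIcc 0 x ⊆ Ioo (-1 : ℝ) 1 := by
      intro t ht
      rcases le_total 0 x with h | h
      · rw [uIcc_of_le h] at ht; exact ⟨by linarith [ht.1], by linarith [ht.2, hx.2]⟩
      · rw [uIcc_of_ge h] at ht; exact ⟨by linarith [ht.1, hx.1], by linarith [ht.2]⟩
    rw [intervalIntegral.integral_eq_sub_of_hasDerivAt (fun t ht => hd t (hsub ht))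
      ((hG.mono_set hsub).intervalIntegrable)]
    ring
  refine ⟨⟨F 0 + ∫ t in (0 : ℝ)..1, G t, F 0 + ∫ t in (0 : ℝ)..(-1), G t, ?_, ?_⟩, ?_⟩
  · have h1 := (hcont' 1 (by norm_num)).mono (s := Ioo (-1 : ℝ) 1) Ioo_subset_Icc_self
    have h2 : 𝓝[Ioo (-1 : ℝ) 1] 1 = 𝓝[<] (1 : ℝ) := nhdsWithin_Ioo_eq_nhdsLT (by norm_num)
    rw [ContinuousWithinAt, h2] at h1
    refine h1.congr' ?_
    rw [← h2]
    filter_upwards [self_mem_nhdsWithin] with x hx using heq x hx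
  · have h1 := (hcont' (-1) (by norm_num)).mono (s := Ioo (-1 : ℝ) 1) Ioo_subset_Icc_self
    have h2 : 𝓝[Ioo (-1 : ℝ) 1] (-1) = 𝓝[>] (-1 : ℝ) := nhdsWithin_Ioo_eq_nhdsGT (by norm_num)
    rw [ContinuousWithinAt, h2] at h1
    refine h1.congr' ?_
    rw [← h2]
    filter_upwards [self_mem_nhdsWithin] with x hx using heq x hx
  · obtain ⟨C, hC⟩ := isCompact_Icc.exists_bound_of_continuousOn hcont'
    exact ⟨C, fun x hx => by rw [← heq x hx]; exact hC x (Ioo_subset_Icc_self hx)⟩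

theorem half_bound {α C : ℝ} (hα : 0 < α) {h h' : ℝ → ℂ}
    (hd : ∀ x ∈ Ico (0 : ℝ) 1, HasDerivAt h (h' x) x)
    (hb : ∀ x ∈ Ico (0 : ℝ) 1, ‖h' x‖ ≤ C * (1 - x) ^ (-α - 1)) :
    ∀ x ∈ Ico (0 : ℝ) 1, ‖h x‖ ≤ ‖h 0‖ + C / α * (1 - x) ^ (-α) := by
  intro x hx
  have hC : 0 ≤ C := by simpa using (norm_nonneg _).trans (hb 0 (by norm_num))
  have hsub : ∀ t ∈ Icc 0 x, t ∈ Ico (0 : ℝ) 1 := fun t ht => ⟨ht.1, by linarith [ht.2, hx.2]⟩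
  have hB : ∀ t ∈ Icc 0 x, HasDerivAt (fun t : ℝ => ‖h 0‖ + C / α * (1 + -1 * t) ^ (-α))
      (C * (1 - t) ^ (-α - 1)) t := by
    intro t ht
    have := (hsub t ht).2
    refine (((xx_rpow_hd (α := -α) (c := 1) (s := -1) (x := t) (by linarith)).const_mul
      (C / α)).const_add ‖h 0‖).congr_deriv ?_
    rw [show (1 + -1 * t) = 1 - t by ring]
    field_simp
  have := image_norm_le_of_norm_deriv_right_le_deriv_boundary' (f := h) (f' := h') (a := 0) (b := x)
    (fun t ht => (hd t (hsub t ht)).continuousAt.continuousWithinAt)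
    (fun t ht => (hd t (hsub t (Ico_subset_Icc_self ht))).hasDerivWithinAt)
    (B := fun t : ℝ => ‖h 0‖ + C / α * (1 + -1 * t) ^ (-α)) (B' := fun t => C * (1 - t) ^ (-α - 1))
    (by simp; positivity)
    (fun t ht => (hB t ht).continuousAt.continuousWithinAt)
    (fun t ht => (hB t (Ico_subset_Icc_self ht)).hasDerivWithinAt)
    (fun t ht => hb t (hsub t (Ico_subset_Icc_self ht))) (right_mem_Icc.2 hx.1)
  rwa [show (1 + -1 * x) = 1 - x by ring] at this

theorem half_bound2 {α β C : ℝ} (hα : 0 < α) (hβ0 : 0 < β) (hβ : β < 1) {h h' : ℝ → ℂ}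
    (hd : ∀ x ∈ Ico (0 : ℝ) 1, HasDerivAt h (h' x) x)
    (hb : ∀ x ∈ Ico (0 : ℝ) 1, ak α β 1 x * ‖h' x‖ ≤ C) :
    ∀ x ∈ Ico (0 : ℝ) 1, ak α β 0 x * ‖h x‖ ≤ 2 * (‖h 0‖ + C / α) := by
  have hb' : ∀ x ∈ Ico (0 : ℝ) 1, ‖h' x‖ ≤ C * (1 - x) ^ (-α - 1) := by
    intro x hx
    have h1 : 0 < 1 - x := by linarith [hx.2]
    have h2 : 1 ≤ 1 + x := by linarith [hx.1]
    have p1 : 0 < (1 - x) ^ (α + 1) := by positivity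
    have := hb x hx
    rw [show -α - 1 = -(α + 1) by ring, Real.rpow_neg h1.le, ← div_eq_mul_inv, le_div_iff₀ p1]
    refine le_trans ?_ this
    rw [mul_comm]
    refine mul_le_mul_of_nonneg_right ?_ (norm_nonneg _)
    unfold ak
    have : 1 ≤ (1 + x) ^ (β + ((1 : ℕ) : ℝ)) := Real.one_le_rpow h2 (by push_cast; linarith)
    push_cast at *
    nlinarith
  intro x hx
  have hC : 0 ≤ C := by simpa using (norm_nonneg _).trans (hb' 0 (by norm_num))
  have h0 := half_bound hα hd hb' x hx
  have h1 : 0 < 1 - x := by linarith [hx.2]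
  have h2 : 1 ≤ 1 + x := by linarith [hx.1]
  have p1 : 0 < (1 - x) ^ α := by positivity
  have p2 : (1 - x) ^ α ≤ 1 := Real.rpow_le_one h1.le (by linarith [hx.1]) hα.le
  have p3 : (1 + x) ^ β ≤ 2 := by
    calc (1 + x) ^ β ≤ (1 + x) ^ (1 : ℝ) := Real.rpow_le_rpow_of_exponent_le h2 hβ.le
      _ = 1 + x := Real.rpow_one _
      _ ≤ 2 := by linarith [hx.2]
  have p4 : 0 ≤ (1 + x) ^ β := by positivity
  have hw : (1 - x) ^ α * (1 - x) ^ (-α) = 1 := by rw [← Real.rpow_add h1]; simp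
  have hak : ak α β 0 x = (1 - x) ^ α * (1 + x) ^ β := by simp [ak]
  rw [hak]
  calc (1 - x) ^ α * (1 + x) ^ β * ‖h x‖
      ≤ (1 - x) ^ α * (1 + x) ^ β * (‖h 0‖ + C / α * (1 - x) ^ (-α)) := by gcongr
    _ = (1 + x) ^ β * ((1 - x) ^ α * ‖h 0‖ + C / α * ((1 - x) ^ α * (1 - x) ^ (-α))) := by ring
    _ = (1 + x) ^ β * ((1 - x) ^ α * ‖h 0‖ + C / α) := by rw [hw, mul_one]
    _ ≤ 2 * (1 * ‖h 0‖ + C / α) := by gcongr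
    _ = _ := by ring

theorem ak_neg (α β : ℝ) (k : ℕ) (x : ℝ) : ak α β k (-x) = ak β α k x := by
  unfold ak
  rw [mul_comm]
  congr 2; ring

theorem full_bound {α β : ℝ} (hα0 : 0 < α) (hα1 : α < 1) (hβ0 : 0 < β) (hβ1 : β < 1) {h h' : ℝ → ℂ}
    (hd : ∀ x ∈ Ioo (-1 : ℝ) 1, HasDerivAt h (h' x) x)
    (hb : Bdd (fun x => ((ak α β 1 x : ℝ) : ℂ) * h' x)) :
    Bdd (fun x => ((ak α β 0 x : ℝ) : ℂ) * h x) := by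
  obtain ⟨C, hC⟩ := hb
  have hC' : ∀ x ∈ Ioo (-1 : ℝ) 1, ak α β 1 x * ‖h' x‖ ≤ C := by
    intro x hx
    have := hC x hx
    rwa [norm_mul, Complex.norm_real, Real.norm_of_nonneg (ak_pos _ _ _ hx).le] at this
  have A := half_bound2 (h := h) (h' := h') hα0 hβ0 hβ1
    (fun x hx => hd x ⟨by linarith [hx.1], hx.2⟩)
    (fun x hx => hC' x ⟨by linarith [hx.1], hx.2⟩)
  have B := half_bound2 (h := fun x => h (-x)) (h' := fun x => - h' (-x)) (C := C) hβ0 hα0 hα1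
    (fun x hx => by
      have := (hd (-x) ⟨by linarith [hx.2], by linarith [hx.1]⟩).scomp x (hasDerivAt_neg x)
      simpa [Function.comp_def] using this)
    (fun x hx => by
      rw [norm_neg, ← ak_neg]
      exact hC' (-x) ⟨by linarith [hx.2], by linarith [hx.1]⟩)
  refine ⟨max (2 * (‖h 0‖ + C / α)) (2 * (‖h (-0)‖ + C / β)), fun x hx => ?_⟩
  rw [norm_mul, Complex.norm_real, Real.norm_of_nonneg (ak_pos _ _ _ hx).le]
  rcases le_total 0 x with h0 | h0
  · exact (A x ⟨h0, hx.2⟩).trans (le_max_left _ _)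
  · have := B (-x) ⟨by linarith, by linarith [hx.1]⟩
    rw [← ak_neg, neg_neg] at this
    exact this.trans (le_max_right _ _)

theorem l2_l1 {α β : ℝ} (hα0 : 0 < α) (hβ0 : 0 < β) {h : ℝ → ℂ}
    (hc : ContinuousOn h (Ioo (-1 : ℝ) 1)) (h2 : MemL2ab α β h) :
    IntegrableOn (fun x => ((ak α β 0 x : ℝ) : ℂ) * h x) (Ioo (-1 : ℝ) 1) := by
  have hw : IntegrableOn (ak α β 0) (Ioo (-1 : ℝ) 1) := by
    have : Continuous (ak α β 0) := by
      unfold ak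
      exact ((continuous_const.sub continuous_id).rpow_const (fun _ => Or.inr (by simpa using hα0.le))).mul
        ((continuous_const.add continuous_id).rpow_const (fun _ => Or.inr (by simpa using hβ0.le)))
    exact (this.continuousOn.integrableOn_compact isCompact_Icc).mono_set Ioo_subset_Icc_self
  refine Integrable.mono' (hw.add h2) ?_ ?_
  · exact ((Complex.continuous_ofReal.comp_continuousOn (ak_continuousOn α β 0)).mul
      hc).aestronglyMeasurable measurableSet_Ioo
  · refine (ae_restrict_iff' measurableSet_Ioo).2 (Eventually.of_forall fun x hx => ?_)
    have hp := ak_pos α β 0 hx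
    rw [norm_mul, Complex.norm_real, Real.norm_of_nonneg hp.le]
    have e : ‖h x‖ ^ 2 * (1 - x) ^ α * (1 + x) ^ β = ak α β 0 x * ‖h x‖ ^ 2 := by
      simp [ak]; ring
    simp only [Pi.add_apply]
    rw [e]
    nlinarith [sq_nonneg (‖h x‖ - 1), sq_nonneg (‖h x‖), mul_nonneg hp.le (sq_nonneg (‖h x‖ - 1)), mul_nonneg hp.le (sq_nonneg (‖h x‖))]

theorem cont_wD (α β : ℝ) {h : ℝ → ℂ} {m k j : ℕ} (hk : k ≤ m)
    (hh : ContDiffOn ℝ (m : WithTop ℕ∞) h (Ioo (-1 : ℝ) 1)) :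
    ContinuousOn (fun x => ((ak α β j x : ℝ) : ℂ) * iteratedDeriv k h x) (Ioo (-1 : ℝ) 1) := by
  obtain ⟨d, rfl⟩ := Nat.exists_eq_add_of_le hk
  refine (Complex.continuous_ofReal.comp_continuousOn (ak_continuousOn α β j)).mul ?_
  exact (contDiffOn_iter (m := d) (k := k) (by rwa [add_comm])).continuousOn

section main
variable {α β : ℝ} {f : ℝ → ℂ} {n : ℕ}

theorem wh_int (hα0 : 0 < α) (hα1 : α < 1) (hβ0 : 0 < β) (hβ1 : β < 1)
    (hf : ∀ i ≤ n, ContDiffOn ℝ ((2 * (n - i) : ℕ) : WithTop ℕ∞) ((jacobiL α β)^[i] f) (Ioo (-1 : ℝ) 1))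
    (hL : MemL2ab α β ((jacobiL α β)^[n] f)) (d : ℕ) : ∀ i, i + d = n →
    IntegrableOn (fun x => ((ak α β 0 x : ℝ) : ℂ) * (jacobiL α β)^[i] f x) (Ioo (-1 : ℝ) 1) ∧
    (0 < d → Bdd (fun x => ((ak α β 0 x : ℝ) : ℂ) * (jacobiL α β)^[i] f x)) := by
  induction d with
  | zero =>
    intro i hi
    obtain rfl : i = n := by omega
    exact ⟨l2_l1 hα0 hβ0 (hf i le_rfl).continuousOn hL, fun h => absurd h (lt_irrefl 0)⟩
  | succ d ih =>
    intro i hi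
    have h1 := (ih (i + 1) (by omega)).1
    rw [Function.iterate_succ_apply'] at h1
    have hc := hf i (by omega)
    set h := (jacobiL α β)^[i] f
    have hl := lims_of_deriv (fun x hx => key_hd α β (h := h) 0
      (hc.of_le (by norm_cast; omega)) hx) (by
        simpa [lam] using h1.neg)
    have hb : Bdd (fun x => ((ak α β 0 x : ℝ) : ℂ) * h x) := by
      refine full_bound hα0 hα1 hβ0 hβ1 (h' := iteratedDeriv 1 h) (fun x hx => ?_) hl.2
      simpa using hasDerivAt_iter (k := 0) hc (by omega) hx
    refine ⟨hb.integrableOn ?_, fun _ => hb⟩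
    simpa using cont_wD α β (k := 0) (j := 0) (Nat.zero_le _) hc

theorem wD_lims (hα0 : 0 < α) (hα1 : α < 1) (hβ0 : 0 < β) (hβ1 : β < 1)
    (hf : ∀ i ≤ n, ContDiffOn ℝ ((2 * (n - i) : ℕ) : WithTop ℕ∞) ((jacobiL α β)^[i] f) (Ioo (-1 : ℝ) 1))
    (hL : MemL2ab α β ((jacobiL α β)^[n] f)) (j : ℕ) : ∀ i, i + (j + 1) ≤ n →
    HasLims (fun x => ((ak α β (j + 1) x : ℝ) : ℂ) * iteratedDeriv (j + 1) ((jacobiL α β)^[i] f) x) ∧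
    Bdd (fun x => ((ak α β (j + 1) x : ℝ) : ℂ) * iteratedDeriv (j + 1) ((jacobiL α β)^[i] f) x) := by
  have aux : ∀ j : ℕ, (∀ i, i + j ≤ n → IntegrableOn (fun x => ((ak α β j x : ℝ) : ℂ) *
      iteratedDeriv j ((jacobiL α β)^[i] f) x) (Ioo (-1 : ℝ) 1)) → ∀ i, i + (j + 1) ≤ n →
    HasLims (fun x => ((ak α β (j + 1) x : ℝ) : ℂ) * iteratedDeriv (j + 1) ((jacobiL α β)^[i] f) x) ∧
    Bdd (fun x => ((ak α β (j + 1) x : ℝ) : ℂ) * iteratedDeriv (j + 1) ((jacobiL α β)^[i] f) x) := by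
    intro j hj i hi
    have h1 := hj i (by omega)
    have h2 := hj (i + 1) (by omega)
    rw [Function.iterate_succ_apply'] at h2
    exact lims_of_deriv (fun x hx => key_hd α β (h := (jacobiL α β)^[i] f) j
      ((hf i (by omega)).of_le (by norm_cast; omega)) hx) ((h1.const_mul _).sub h2)
  apply aux
  induction j with
  | zero =>
    intro i hi
    simpa using (wh_int hα0 hα1 hβ0 hβ1 hf hL (n - i) i (by omega)).1
  | succ j ih =>
    intro i hi
    exact (aux j ih i hi).2.integrableOn (cont_wD α β (by omega) (hf i (by omega)))

theorem wD_bdd (hα0 : 0 < α) (hα1 : α < 1) (hβ0 : 0 < β) (hβ1 : β < 1)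
    (hf : ∀ i ≤ n, ContDiffOn ℝ ((2 * (n - i) : ℕ) : WithTop ℕ∞) ((jacobiL α β)^[i] f) (Ioo (-1 : ℝ) 1))
    (hL : MemL2ab α β ((jacobiL α β)^[n] f)) (j : ℕ) (hj : j < n) :
    Bdd (fun x => ((ak α β j x : ℝ) : ℂ) * iteratedDeriv j f x) := by
  cases j with
  | zero => simpa using (wh_int hα0 hα1 hβ0 hβ1 hf hL n 0 (by omega)).2 hj
  | succ j => simpa using (wD_lims hα0 hα1 hβ0 hβ1 hf hL j 0 (by omega)).2

theorem HasLims.congr {F G : ℝ → ℂ} (h : HasLims F) (he : ∀ x ∈ Ioo (-1 : ℝ) 1, G x = F x) :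
    HasLims G := by
  obtain ⟨a, b, ha, hb⟩ := h
  refine ⟨a, b, ha.congr' ?_, hb.congr' ?_⟩
  · filter_upwards [Ioo_mem_nhdsLT (show (-1 : ℝ) < 1 by norm_num)] with x hx using (he x hx).symm
  · filter_upwards [Ioo_mem_nhdsGT (show (-1 : ℝ) < 1 by norm_num)] with x hx using (he x hx).symm

theorem HasLims.sum {ι : Type*} (s : Finset ι) {F : ι → ℝ → ℂ} (c : ι → ℂ) (h : ∀ i ∈ s, HasLims (F i)) :
    HasLims (fun x => ∑ i ∈ s, c i * F i x) := by
  choose! a b ha hb using h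
  exact ⟨_, _, tendsto_finsetSum _ fun i hi => (ha i hi).const_mul (c i),
    tendsto_finsetSum _ fun i hi => (hb i hi).const_mul (c i)⟩

theorem second_lims (hα0 : 0 < α) (hα1 : α < 1) (hβ0 : 0 < β) (hβ1 : β < 1)
    (hf : ∀ i ≤ n, ContDiffOn ℝ ((2 * (n - i) : ℕ) : WithTop ℕ∞) ((jacobiL α β)^[i] f) (Ioo (-1 : ℝ) 1))
    (hL : MemL2ab α β ((jacobiL α β)^[n] f)) (k j : ℕ) (hk : k ≤ n) (hj1 : 1 ≤ j) (hjk : j ≤ k) :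
    HasLims (iteratedDeriv (k - j) (fun y => ((ak α β k y : ℝ) : ℂ) * iteratedDeriv k f y)) := by
  obtain ⟨d, rfl⟩ := Nat.exists_eq_add_of_le hjk
  obtain ⟨j, rfl⟩ := Nat.exists_eq_add_of_le' hj1
  rw [Nat.add_sub_cancel_left]
  obtain ⟨c, hc⟩ := expand α β hf d (j + 1) hk
  refine HasLims.congr (HasLims.sum _ c fun i hi => ?_) hc
  exact (wD_lims hα0 hα1 hβ0 hβ1 hf hL j i (by have := Finset.mem_range.1 hi; omega)).1

end main

open Polynomial in
theorem iter_poly (q : Polynomial ℝ) (k : ℕ) :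
    iteratedDeriv k (fun x : ℝ => ((q.eval x : ℝ) : ℂ)) =
      fun x : ℝ => (((derivative^[k] q).eval x : ℝ) : ℂ) := by
  induction k with
  | zero => simp
  | succ k ih =>
    rw [iteratedDeriv_succ, ih]
    funext x
    rw [Function.iterate_succ_apply']
    exact (ofReal_hd ((derivative^[k] q).hasDerivAt x)).deriv

open Polynomial in
theorem iter_wpoly (α β : ℝ) (d : ℕ) : ∀ (j : ℕ) (q : Polynomial ℝ), ∃ r : Polynomial ℝ,
    ∀ x ∈ Ioo (-1 : ℝ) 1,
      iteratedDeriv d (fun y => ((ak α β (j + d) y : ℝ) : ℂ) * ((q.eval y : ℝ) : ℂ)) x =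
        ((ak α β j x : ℝ) : ℂ) * ((r.eval x : ℝ) : ℂ) := by
  induction d with
  | zero => intro j q; exact ⟨q, fun x _ => by simp⟩
  | succ d ih =>
    intro j q
    obtain ⟨r, hr⟩ := ih (j + 1) q
    refine ⟨(C (β - α) - C (α + β + 2 + 2 * j) * X) * r + (1 - X ^ 2) * derivative r, fun x hx => ?_⟩
    rw [show j + 1 + d = j + (d + 1) by ring] at hr
    rw [iteratedDeriv_succ]
    have ev : iteratedDeriv d (fun y => ((ak α β (j + (d + 1)) y : ℝ) : ℂ) * ((q.eval y : ℝ) : ℂ))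
        =ᶠ[𝓝 x] fun x => ((ak α β (j + 1) x : ℝ) : ℂ) * ((r.eval x : ℝ) : ℂ) := by
      filter_upwards [Ioo_mem_nhds hx.1 hx.2] with y hy using hr y hy
    rw [ev.deriv_eq]
    refine (HasDerivAt.deriv ((ofReal_hd (ak_hasDerivAt α β j hx)).mul
      (ofReal_hd (r.hasDerivAt x)))).trans ?_
    rw [ak_succ _ _ _ hx]
    simp
    ring

/-- coefficients -/
noncomputable def cf (α β : ℝ) (m j : ℕ) : ℝ :=
  (-(1 : ℝ) / 2) ^ j *
      (poch ((m : ℝ) + α + β + 1) j * poch (α + (j : ℝ) + 1) (m - j)) /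
      ((j.factorial : ℝ) * ((m - j).factorial : ℝ))

open Polynomial in
/-- Jacobi polynomial as a polynomial -/
noncomputable def JP (α β : ℝ) (m : ℕ) : Polynomial ℝ :=
  ∑ j ∈ Finset.range (m + 1), C (cf α β m j) * (1 - X) ^ j

theorem JP_eval (α β : ℝ) (m : ℕ) (x : ℝ) : (JP α β m).eval x = jacobiP α β m x := by
  simp [JP, jacobiP, Polynomial.eval_finsetSum, cf]

theorem cf_rec {α β : ℝ} (m j : ℕ) (hj : j < m) :
    (lam α β m - lam α β j) * cf α β m j =
      -(2 * (j + 1) * (j + 1 + α) * cf α β m (j + 1)) := by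
  obtain ⟨d, rfl⟩ := Nat.exists_eq_add_of_lt hj
  unfold cf lam
  rw [show j + d + 1 - j = d + 1 by omega, show j + d + 1 - (j + 1) = d by omega]
  have e1 : ∀ a : ℝ, poch a (j + 1) = poch a j * (a + j) := fun a => by
    simp [poch, Finset.prod_range_succ]
  have e2 : poch (α + (j : ℝ) + 1) (d + 1) = (α + j + 1) * poch (α + ((j + 1 : ℕ) : ℝ) + 1) d := by
    unfold poch
    rw [Finset.prod_range_succ', mul_comm]
    congr 1
    · simp
    · refine Finset.prod_congr rfl fun i _ => ?_
      push_cast; ring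
  rw [e1, e2, Nat.factorial_succ, Nat.factorial_succ, pow_succ]
  have f1 : (j.factorial : ℝ) ≠ 0 := by positivity
  have f2 : (d.factorial : ℝ) ≠ 0 := by positivity
  have f3 : ((j : ℝ) + 1) ≠ 0 := by positivity
  have f4 : ((d : ℝ) + 1) ≠ 0 := by positivity
  push_cast
  field_simp
  ring

open Polynomial in
theorem JP_ode (α β : ℝ) (m : ℕ) :
    (1 - X ^ 2) * derivative (derivative (JP α β m)) +
      (C (β - α) - C (α + β + 2) * X) * derivative (JP α β m) +
      C (lam α β m) * JP α β m = 0 := by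
  have term : ∀ j : ℕ, (1 - X ^ 2) * derivative (derivative ((1 - X : ℝ[X]) ^ j)) +
      (C (β - α) - C (α + β + 2) * X) * derivative ((1 - X : ℝ[X]) ^ j) +
      C (lam α β m) * (1 - X : ℝ[X]) ^ j =
      C (2 * j * (j + α)) * (1 - X) ^ (j - 1) + C (lam α β m - lam α β j) * (1 - X) ^ j := by
    intro j
    rcases j with _ | _ | j
    · simp [lam]
    · simp [lam, derivative_pow, map_ofNat]
      ring
    · simp [lam, derivative_pow, map_ofNat]
      ring
  have hs : (1 - X ^ 2) * derivative (derivative (JP α β m)) +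
      (C (β - α) - C (α + β + 2) * X) * derivative (JP α β m) +
      C (lam α β m) * JP α β m = ∑ j ∈ Finset.range (m + 1),
        C (cf α β m j) * (C (2 * j * (j + α)) * (1 - X) ^ (j - 1) +
          C (lam α β m - lam α β j) * (1 - X) ^ j) := by
    simp only [← term]
    unfold JP
    simp only [derivative_sum, derivative_C_mul, Finset.mul_sum, ← Finset.sum_add_distrib]
    refine Finset.sum_congr rfl fun j _ => ?_
    ring
  rw [hs]
  set U : ℕ → ℝ[X] := fun j => C (cf α β m j * (2 * j * (j + α))) * (1 - X) ^ (j - 1) with hU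
  rw [Finset.sum_range_succ]
  have : ∀ j ∈ Finset.range m, C (cf α β m j) * (C (2 * j * (j + α)) * (1 - X) ^ (j - 1) +
          C (lam α β m - lam α β j) * (1 - X) ^ j) = U j - U (j + 1) := by
    intro j hj
    have h := cf_rec (α := α) (β := β) m j (Finset.mem_range.1 hj)
    have h' : C (cf α β m j) * (C (lam α β m - lam α β j) * (1 - X : ℝ[X]) ^ j) = - U (j + 1) := by
      rw [hU]
      simp only [Nat.add_sub_cancel]
      rw [← mul_assoc, ← C_mul, ← neg_mul, ← C_neg, mul_comm (cf α β m j), h]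
      congr 2
      push_cast; ring
    rw [mul_add, h', hU]
    simp only [C_mul]
    ring
  rw [Finset.sum_congr rfl this, Finset.sum_range_sub']
  simp [hU]
  ring

open Polynomial in
theorem JP_ode_iter (α β : ℝ) (m k : ℕ) :
    (1 - X ^ 2) * derivative^[k + 2] (JP α β m) +
      (C (β - α) - C (α + β + 2 + 2 * k) * X) * derivative^[k + 1] (JP α β m) +
      C (lam α β m - lam α β k) * derivative^[k] (JP α β m) = 0 := by
  induction k with
  | zero => simpa [lam] using JP_ode α β m
  | succ k ih =>
    have h := congrArg derivative ih
    simp only [Function.iterate_succ_apply'] at h ⊢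
    simp [lam, map_ofNat] at h ⊢
    linear_combination h

/-- normalised jets as polynomials in the eigenvalue -/
noncomputable def qq (α β : ℝ) (s : ℕ → ℝ) (k : ℕ) : Polynomial ℝ :=
  ∏ i ∈ Finset.range k, (Polynomial.C (s i) * (Polynomial.X - Polynomial.C (lam α β i)))

theorem qq_deg (α β : ℝ) (s : ℕ → ℝ) (k : ℕ) : (qq α β s k).natDegree ≤ k := by
  refine (Polynomial.natDegree_prod_le _ _).trans ?_
  refine (Finset.sum_le_sum (g := fun _ => 1) fun i _ => ?_).trans (by simp)
  exact (Polynomial.natDegree_C_mul_le _ _).trans (by simp)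

open Polynomial in
theorem jets {α β : ℝ} (hα0 : 0 < α) (hβ0 : 0 < β) {e : ℝ} (he : e = 1 ∨ e = -1) :
    ∃ s : ℕ → ℝ, ∀ m k : ℕ, (derivative^[k] (JP α β m)).eval e =
      (JP α β m).eval e * (qq α β s k).eval (lam α β m) := by
  have ss : ∃ s : ℕ → ℝ, ∀ m k : ℕ, (derivative^[k + 1] (JP α β m)).eval e =
      s k * (lam α β m - lam α β k) * (derivative^[k] (JP α β m)).eval e := by
    rcases he with rfl | rfl
    · refine ⟨fun k => 1 / (2 * (α + k + 1)), fun m k => ?_⟩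
      have h := congrArg (eval 1) (JP_ode_iter α β m k)
      simp only [eval_add, eval_mul, eval_sub, eval_one, eval_pow, eval_X, eval_C, eval_zero] at h
      have : 2 * (α + k + 1) ≠ 0 := by positivity
      field_simp
      linear_combination -h
    · refine ⟨fun k => -1 / (2 * (β + k + 1)), fun m k => ?_⟩
      have h := congrArg (eval (-1)) (JP_ode_iter α β m k)
      simp only [eval_add, eval_mul, eval_sub, eval_one, eval_pow, eval_X, eval_C, eval_zero] at h
      have : 2 * (β + k + 1) ≠ 0 := by positivity
      field_simp
      linear_combination h
  obtain ⟨s, hs⟩ := ss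
  refine ⟨s, fun m k => ?_⟩
  induction k with
  | zero => simp [qq]
  | succ k ih =>
    rw [hs, ih]
    simp only [qq, Finset.prod_range_succ, eval_mul, eval_C, eval_sub, eval_X]
    ring

open Polynomial in
theorem JP_ne {α β : ℝ} (hα0 : 0 < α) (hβ0 : 0 < β) {e : ℝ} (he : e = 1 ∨ e = -1) (m : ℕ) :
    (JP α β m).eval e ≠ 0 := by
  intro h0
  obtain ⟨s, hs⟩ := jets hα0 hβ0 he
  have hz : JP α β m = 0 := by
    apply Polynomial.eq_zero_of_hasseDeriv_eq_zero _ e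
    intro k
    have h1 := hs m k
    rw [h0, zero_mul, ← Polynomial.factorial_smul_hasseDeriv] at h1
    simpa [Nat.factorial_ne_zero] using h1
  have h1 : (JP α β m).eval 1 = cf α β m 0 := by
    simp [JP, Polynomial.eval_finsetSum, Finset.sum_range_succ']
  have h2 : 0 < cf α β m 0 := by
    have : 0 < poch (α + ((0 : ℕ) : ℝ) + 1) (m - 0) := by
      unfold poch
      exact Finset.prod_pos fun i _ => by positivity
    have h3 : poch ((m : ℝ) + α + β + 1) 0 = 1 := by simp [poch]
    unfold cf
    rw [h3]
    positivity
  rw [hz] at h1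
  simp at h1
  linarith

theorem lam_inj {α β : ℝ} (hα0 : 0 < α) (hβ0 : 0 < β) : Function.Injective (lam α β) := by
  intro a b h
  unfold lam at h
  have h1 : ((a : ℝ) - b) * (a + b + α + β + 1) = 0 := by linear_combination h
  have h2 : (a : ℝ) + b + α + β + 1 ≠ 0 := by positivity
  have := (mul_eq_zero.1 h1).resolve_right h2
  exact_mod_cast sub_eq_zero.1 this

theorem sesq_lim {α β : ℝ} {f : ℝ → ℂ} {n : ℕ} {e : ℝ} (he : e = 1 ∨ e = -1) {l : Filter ℝ}
    (hl : l ≤ 𝓝 e) (hI : Ioo (-1 : ℝ) 1 ∈ l)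
    (hb : ∀ j < n, Bdd (fun x => ((ak α β j x : ℝ) : ℂ) * iteratedDeriv j f x))
    (A : ℕ → ℕ → ℂ)
    (hA : ∀ k j, k ≤ n → 1 ≤ j → j ≤ k → Tendsto (iteratedDeriv (k - j)
      (fun y => ((ak α β k y : ℝ) : ℂ) * iteratedDeriv k f y)) l (𝓝 (A k j))) (q : Polynomial ℝ) :
    Tendsto (sesq α β n f (fun x : ℝ => ((q.eval x : ℝ) : ℂ))) l
      (𝓝 (∑ k ∈ Finset.Icc 1 n, ∑ j ∈ Finset.Icc 1 k, (-1 : ℂ) ^ (k + j) *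
        (0 - A k j * (((Polynomial.derivative^[j - 1] q).eval e : ℝ) : ℂ)))) := by
  unfold sesq
  refine tendsto_finsetSum _ fun k hk => tendsto_finsetSum _ fun j hj => ?_
  rw [Finset.mem_Icc] at hk hj
  refine Tendsto.const_mul _ (Tendsto.sub ?_ (Tendsto.mul (hA k j hk.2 hj.1 hj.2) ?_))
  · obtain ⟨d, rfl⟩ := Nat.exists_eq_add_of_le hj.2
    obtain ⟨j, rfl⟩ := Nat.exists_eq_add_of_le' hj.1
    rw [Nat.add_sub_cancel_left, Nat.add_sub_cancel]
    simp only [iter_poly]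
    obtain ⟨r, hr⟩ := iter_wpoly α β d (j + 1) (Polynomial.derivative^[j + 1 + d] q)
    obtain ⟨K, hK⟩ := hb j (by omega)
    have h1 : Tendsto (fun x : ℝ => (((((1 - Polynomial.X ^ 2) * r).eval x : ℝ)) : ℂ)) l (𝓝 0) := by
      have hc : Continuous (fun x : ℝ => (((((1 - Polynomial.X ^ 2) * r).eval x : ℝ)) : ℂ)) :=
        Complex.continuous_ofReal.comp (Polynomial.continuous _)
      have := (hc.tendsto e).mono_left hl
      convert this using 2
      rcases he with rfl | rfl <;> simp
    have h2 := h1.zero_mul_isBoundedUnder_le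
      (g := fun x => ((ak α β j x : ℝ) : ℂ) * iteratedDeriv j f x)
      ⟨K, by
        rw [eventually_map]
        filter_upwards [hI] with x hx using hK x hx⟩
    refine h2.congr' ?_
    filter_upwards [hI] with x hx
    rw [hr x hx, ak_succ _ _ _ hx]
    simp
    ring
  · simp only [iter_poly]
    have hc : Continuous (fun x : ℝ => (((Polynomial.derivative^[j - 1] q).eval x : ℝ) : ℂ)) :=
      Complex.continuous_ofReal.comp (Polynomial.continuous _)
    exact (hc.tendsto e).mono_left hl

theorem endpoint {α β : ℝ} (hα0 : 0 < α) (hβ0 : 0 < β) {f : ℝ → ℂ} {n : ℕ} {e : ℝ}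
    (he : e = 1 ∨ e = -1) {l : Filter ℝ} [l.NeBot]
    (hl : l ≤ 𝓝 e) (hI : Ioo (-1 : ℝ) 1 ∈ l)
    (hb : ∀ j < n, Bdd (fun x => ((ak α β j x : ℝ) : ℂ) * iteratedDeriv j f x))
    (hA : ∀ k j, k ≤ n → 1 ≤ j → j ≤ k → ∃ a, Tendsto (iteratedDeriv (k - j)
      (fun y => ((ak α β k y : ℝ) : ℂ) * iteratedDeriv k f y)) l (𝓝 a))
    (M : Finset ℕ) (hM : M.card = n)
    (h : ∀ m ∈ M, Tendsto (sesq α β n f (fun x : ℝ => ((jacobiP α β m x : ℝ) : ℂ))) l (𝓝 0)) (m : ℕ) :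
    Tendsto (sesq α β n f (fun x : ℝ => ((jacobiP α β m x : ℝ) : ℂ))) l (𝓝 0) := by
  choose! A hA using hA
  obtain ⟨s, hs⟩ := jets hα0 hβ0 he
  set R : Polynomial ℂ := ∑ k ∈ Finset.Icc 1 n, ∑ j ∈ Finset.Icc 1 k,
    Polynomial.C (-((-1 : ℂ) ^ (k + j) * A k j)) * (qq α β s (j - 1)).map (algebraMap ℝ ℂ) with hR
  have hlim : ∀ m, Tendsto (sesq α β n f (fun x : ℝ => ((jacobiP α β m x : ℝ) : ℂ))) l
      (𝓝 ((((JP α β m).eval e : ℝ) : ℂ) * R.eval ((lam α β m : ℝ) : ℂ))) := by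
    intro m
    have := sesq_lim he hl hI hb A hA (JP α β m)
    simp only [JP_eval] at this
    convert this using 2
    rw [hR]
    simp only [Polynomial.eval_finsetSum, Finset.mul_sum]
    refine Finset.sum_congr rfl fun k _ => Finset.sum_congr rfl fun j _ => ?_
    rw [hs, Polynomial.eval_mul, Polynomial.eval_C]
    have : ((qq α β s (j - 1)).map (algebraMap ℝ ℂ)).eval ((lam α β m : ℝ) : ℂ) =
        (((qq α β s (j - 1)).eval (lam α β m) : ℝ) : ℂ) := by
      rw [Polynomial.eval_map, ← Complex.coe_algebraMap, Polynomial.eval₂_at_apply]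
    rw [this, JP_eval]
    push_cast
    ring
  have hR0 : R = 0 := by
    rcases Nat.eq_zero_or_pos n with rfl | hn
    · simp [hR]
    have hdeg : R.natDegree ≤ n - 1 := by
      rw [hR]
      refine Polynomial.natDegree_sum_le_of_forall_le _ _ fun k hk => ?_
      refine Polynomial.natDegree_sum_le_of_forall_le _ _ fun j hj => ?_
      rw [Finset.mem_Icc] at hk hj
      refine (Polynomial.natDegree_C_mul_le _ _).trans ?_
      refine Polynomial.natDegree_map_le.trans ?_
      exact (qq_deg _ _ _ _).trans (by omega)
    have inj : Function.Injective (fun m => ((lam α β m : ℝ) : ℂ)) :=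
      Complex.ofReal_injective.comp (lam_inj hα0 hβ0)
    refine Polynomial.eq_zero_of_natDegree_lt_card_of_eval_eq_zero' R
      (M.image (fun m => ((lam α β m : ℝ) : ℂ))) ?_ ?_
    · intro z hz
      obtain ⟨m, hm, rfl⟩ := Finset.mem_image.1 hz
      have := tendsto_nhds_unique (hlim m) (h m hm)
      refine (mul_eq_zero.1 this).resolve_left ?_
      exact_mod_cast JP_ne hα0 hβ0 he m
    · rw [Finset.card_image_of_injective _ inj, hM]
      omega
  have := hlim m
  rwa [hR0, Polynomial.eval_zero, mul_zero] at this

theorem both_ends {α β : ℝ}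
    (hα0 : 0 < α) (hα1 : α < 1) (hβ0 : 0 < β) (hβ1 : β < 1) {n : ℕ} {f : ℝ → ℂ}
    (hf : JacobiMaxDom α β n f) (M : Finset ℕ) (hM : M.card = n)
    (h : ∀ m ∈ M,
        Tendsto (sesq α β n f (fun x : ℝ => ((jacobiP α β m x : ℝ) : ℂ)))
          (𝓝[<] (1 : ℝ)) (𝓝 0) ∧
        Tendsto (sesq α β n f (fun x : ℝ => ((jacobiP α β m x : ℝ) : ℂ)))
          (𝓝[>] (-1 : ℝ)) (𝓝 0)) (m : ℕ) :
    Tendsto (sesq α β n f (fun x : ℝ => ((jacobiP α β m x : ℝ) : ℂ)))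
          (𝓝[<] (1 : ℝ)) (𝓝 0) ∧
        Tendsto (sesq α β n f (fun x : ℝ => ((jacobiP α β m x : ℝ) : ℂ)))
          (𝓝[>] (-1 : ℝ)) (𝓝 0) := by
  obtain ⟨h1, -, h3⟩ := hf
  have hc := contDiff_iterate α β (f := f) (n := n) (by exact_mod_cast h1)
  have hb := wD_bdd hα0 hα1 hβ0 hβ1 hc h3
  have hl := second_lims hα0 hα1 hβ0 hβ1 hc h3
  constructor
  · refine endpoint hα0 hβ0 (Or.inl rfl) nhdsWithin_le_nhds (Ioo_mem_nhdsLT (by norm_num)) hb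
      (fun k j a b c => ?_) M hM (fun m hm => (h m hm).1) m
    obtain ⟨u, v, hu, hv⟩ := hl k j a b c
    exact ⟨u, hu⟩
  · refine endpoint hα0 hβ0 (Or.inr rfl) nhdsWithin_le_nhds (Ioo_mem_nhdsGT (by norm_num)) hb
      (fun k j a b c => ?_) M hM (fun m hm => (h m hm).2) m
    obtain ⟨u, v, hu, hv⟩ := hl k j a b c
    exact ⟨v, hv⟩

/-- GKN boundary conditions built from any `n` distinct Jacobi polynomials determine the
same subset of the maximal domain as those built from the first `n` Jacobi polynomials. -/
theorem jacobi_gkn_any_n_polynomials (α β : ℝ)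
    (hα0 : 0 < α) (hα1 : α < 1) (hβ0 : 0 < β) (hβ1 : β < 1) (n : ℕ) (hn : 1 ≤ n)
    (M : Finset ℕ) (hM : M.card = n) :
    {f : ℝ → ℂ | JacobiMaxDom α β n f ∧ ∀ j < n,
        Tendsto (sesq α β n f (fun x : ℝ => ((jacobiP α β j x : ℝ) : ℂ)))
          (𝓝[<] (1 : ℝ)) (𝓝 0) ∧
        Tendsto (sesq α β n f (fun x : ℝ => ((jacobiP α β j x : ℝ) : ℂ)))
          (𝓝[>] (-1 : ℝ)) (𝓝 0)} =
    {f : ℝ → ℂ | JacobiMaxDom α β n f ∧ ∀ m ∈ M,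
        Tendsto (sesq α β n f (fun x : ℝ => ((jacobiP α β m x : ℝ) : ℂ)))
          (𝓝[<] (1 : ℝ)) (𝓝 0) ∧
        Tendsto (sesq α β n f (fun x : ℝ => ((jacobiP α β m x : ℝ) : ℂ)))
          (𝓝[>] (-1 : ℝ)) (𝓝 0)} := by
  ext f
  constructor
  · rintro ⟨hf, h⟩
    exact ⟨hf, fun m _ => both_ends hα0 hα1 hβ0 hβ1 hf (Finset.range n) (Finset.card_range n)
      (fun j hj => h j (Finset.mem_range.1 hj)) m⟩
  · rintro ⟨hf, h⟩
    exact ⟨hf, fun j _ => both_ends hα0 hα1 hβ0 hβ1 hf M hM h j⟩
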